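/- Let G = (X,E) be a tree of bounded degree without dead ends and z ∈ ℂ ∖ {0}. Then for every μ ∈ D'(Ω) and every edge e ∈ E, the scalar and edge Poisson transforms are related by z·P_z μ(τ(e)) − P_z μ(ι(e)) = (z² − 1)·P^e_z μ(e). -/

import Mathlib

open Function Set
open scoped Classical

namespace GraphQCC

variable {X : Type} (G : SimpleGraph X)

/-- The set of directed edges of a (symmetric, loopless) graph. -/
abbrev DE := {p : X × X // G.Adj p.1 p.2}

variable {G}

/-- Initial vertex of a directed edge. -/
def ini (e : DE G) : X := e.1.1

/-- Terminal vertex of a directed edge. -/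
def ter (e : DE G) : X := e.1.2

/-- Opposite edge. -/
def op (e : DE G) : DE G := ⟨(e.1.2, e.1.1), e.2.symm⟩

variable (G)

/-- Degree of a vertex: the number of directed edges starting at it. -/
noncomputable def deg (x : X) : ℕ := Set.ncard {e : DE G | ini e = x}

/-- The graph is locally finite: every vertex has finite degree. -/
def LocFin : Prop := ∀ x : X, {e : DE G | ini e = x}.Finite

/-- The edge Laplacian. -/
noncomputable def edgeLap (f : DE G → ℂ) (e : DE G) : ℂ :=
  ∑ᶠ e' ∈ {e' : DE G | ini e' = ter e ∧ e' ≠ op e}, f e'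

/-- The `z`-eigenspace of the edge Laplacian, as a set of functions on directed edges. -/
def edgeEig (z : ℂ) : Set (DE G → ℂ) := {f | ∀ e, edgeLap G f e = z * f e}

/-- The edge inversion operator Ξ. -/
def Xi (f : DE G → ℂ) (e : DE G) : ℂ := f (op e)

/-- The operator Σ (sum over edges with the same initial point). -/
noncomputable def Sig (f : DE G → ℂ) (e : DE G) : ℂ :=
  ∑ᶠ e' ∈ {e' : DE G | ini e' = ini e}, f e'

/-- Edges pointing away from a vertex `o`. -/
def away (o : X) : Set (DE G) := {e | G.dist o (ter e) = G.dist o (ini e) + 1}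

/-- The edge Laplacian on functions on the edges pointing away from `o`. -/
noncomputable def edgeLapAway (o : X) (f : ↥(away G o) → ℂ) (e : ↥(away G o)) : ℂ :=
  ∑ᶠ e' ∈ {e' : ↥(away G o) | ini e'.1 = ter e.1 ∧ e'.1 ≠ op e.1}, f e'

/-- The `z`-eigenspace of the edge Laplacian on edges pointing away from `o`. -/
def edgeEigAway (o : X) (z : ℂ) : Set (↥(away G o) → ℂ) :=
  {f | ∀ e, edgeLapAway G o f e = z * f e}

/-! ## Boundary at infinity -/

/-- A ray: an infinite non-backtracking chain of vertices. -/
def IsRay (r : ℕ → X) : Prop := (∀ n, G.Adj (r n) (r (n + 1))) ∧ ∀ n, r (n + 2) ≠ r n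

abbrev Ray := {r : ℕ → X // IsRay G r}

/-- Two rays are equivalent if they share infinitely many vertices. -/
def RayRel (r r' : Ray G) : Prop := (Set.range r.1 ∩ Set.range r'.1).Infinite

/-- The boundary at infinity: equivalence classes of rays. -/
def Boundary := Quot (RayRel G)

/-- The set `∂₊ e` of boundary points reachable by a non-backtracking chain starting with `e`. -/
def plusBd (e : DE G) : Set (Boundary G) :=
  {ω | ∃ r : Ray G, Quot.mk (RayRel G) r = ω ∧ r.1 0 = ini e ∧ r.1 1 = ter e}

/-- The topology on the boundary generated by the sets `∂₊ e`. -/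
instance : TopologicalSpace (Boundary G) :=
  TopologicalSpace.generateFrom {s | ∃ e : DE G, s = plusBd G e}

/-- The space of locally constant functions on the boundary. -/
noncomputable def Clc : Submodule ℂ (Boundary G → ℂ) where
  carrier := {f | IsLocallyConstant f}
  add_mem' hf hg := hf.comp₂ hg (· + ·)
  zero_mem' := IsLocallyConstant.const 0
  smul_mem' c f hf := hf.comp (c * ·)

/-- `D'(Ω)`: the algebraic dual of the space of locally constant functions on the boundary. -/
abbrev DualB := Module.Dual ℂ ↥(Clc G)

/-- Pairing of a functional on `C^lc(Ω)` with a function on the boundary. -/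
noncomputable def pairB (μ : DualB G) (g : Boundary G → ℂ) : ℂ :=
  if h : IsLocallyConstant g then μ ⟨g, h⟩ else 0

/-- The horocycle bracket `⟨x, ω⟩` with respect to the base point `o`: the unique integer `k`
such that `d(x, r n) = n - k` for every ray `r` from `o` representing `ω` and all large `n`. -/
noncomputable def horo (o x : X) (ω : Boundary G) : ℤ :=
  if h : ∃ k : ℤ, ∀ r : Ray G, Quot.mk (RayRel G) r = ω → r.1 0 = o →
      ∃ N : ℕ, ∀ n : ℕ, N ≤ n → (G.dist x (r.1 n) : ℤ) = (n : ℤ) - k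
  then h.choose else 0

/-- The scalar Poisson transform. -/
noncomputable def poisson (o : X) (z : ℂ) (μ : DualB G) (x : X) : ℂ :=
  pairB G μ fun ω => z ^ horo G o x ω

/-- The edge Poisson transform. -/
noncomputable def edgePoisson (o : X) (z : ℂ) (μ : DualB G) (e : DE G) : ℂ :=
  pairB G μ fun ω => z ^ horo G o (ini e) ω * Set.indicator (plusBd G e) 1 ω

/-! ## The shift space of non-backtracking chains of edges -/

/-- An infinite concatenated non-backtracking sequence of directed edges. -/
def IsChainSeq (c : ℕ → DE G) : Prop :=
  ∀ i, ter (c i) = ini (c (i + 1)) ∧ ter (c (i + 1)) ≠ ini (c i)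

/-- The shift space `𝔓`. -/
abbrev ChainSp := {c : ℕ → DE G // IsChainSeq G c}

/-- The one-sided shift on chains. -/
def shift (c : ChainSp G) : ChainSp G := ⟨fun n => c.1 (n + 1), fun i => c.2 (i + 1)⟩

/-- The district (cylinder) topology on the shift space. -/
instance : TopologicalSpace (ChainSp G) :=
  TopologicalSpace.generateFrom
    {s | ∃ (c₀ : ChainSp G) (n : ℕ), s = {c : ChainSp G | ∀ i ≤ n, c.1 i = c₀.1 i}}

/-- The Ruelle transfer operator. -/
noncomputable def transfer (F : ChainSp G → ℂ) (c : ChainSp G) : ℂ :=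
  ∑ᶠ c' ∈ {c' : ChainSp G | shift G c' = c}, F c'

/-- Functions on chains depending only on the first `N` edges. -/
def cylFun (N : ℕ) : Set (ChainSp G → ℂ) :=
  {F | ∀ c c' : ChainSp G, (∀ i < N, c.1 i = c'.1 i) → F c = F c'}

/-- The ray of initial vertices of a chain of edges. -/
def toRay (c : ChainSp G) : Ray G :=
  ⟨fun n => ini (c.1 n), by
    refine ⟨fun n => ?_, fun n => ?_⟩
    · have h1 : ter (c.1 n) = ini (c.1 (n + 1)) := (c.2 n).1
      have h2 : G.Adj (ini (c.1 n)) (ter (c.1 n)) := (c.1 n).2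
      rwa [h1] at h2
    · have h1 : ter (c.1 (n + 1)) = ini (c.1 (n + 2)) := (c.2 (n + 1)).1
      have h2 : ter (c.1 (n + 1)) ≠ ini (c.1 n) := (c.2 n).2
      rwa [h1] at h2⟩

/-- The endpoint map `B : 𝔓 → Ω`. -/
def endB (c : ChainSp G) : Boundary G := Quot.mk (RayRel G) (toRay G c)

/-- The pushforward `B_⋆` by fiber summation. -/
noncomputable def push (f : ChainSp G → ℂ) (ω : Boundary G) : ℂ :=
  ∑ᶠ c ∈ {c : ChainSp G | endB G c = ω}, f c

/-- The space of locally constant compactly supported functions on the shift space. -/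
noncomputable def CcP : Submodule ℂ (ChainSp G → ℂ) where
  carrier := {F | IsLocallyConstant F ∧ HasCompactSupport F}
  add_mem' hf hg := ⟨hf.1.comp₂ hg.1 (· + ·), hf.2.add hg.2⟩
  zero_mem' := ⟨IsLocallyConstant.const 0, HasCompactSupport.zero⟩
  smul_mem' c f hf := ⟨hf.1.comp (c * ·),
    hf.2.mono fun x hx h0 => hx (by simp [h0])⟩

/-- `D'(𝔓)`: the algebraic dual of `C^lc_c(𝔓)`. -/
abbrev DualP := Module.Dual ℂ ↥(CcP G)

/-- Pairing of a functional on `C^lc_c(𝔓)` with a function on the shift space. -/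
noncomputable def pairP (lam : DualP G) (g : ChainSp G → ℂ) : ℂ :=
  if h : g ∈ CcP G then lam ⟨g, h⟩ else 0

/-- The space of locally constant functions on the shift space (for finite graphs this is
`C^lc_c(𝔓)` since `𝔓` is compact). -/
noncomputable def ClcP : Submodule ℂ (ChainSp G → ℂ) where
  carrier := {F | IsLocallyConstant F}
  add_mem' hf hg := hf.comp₂ hg (· + ·)
  zero_mem' := IsLocallyConstant.const 0
  smul_mem' c f hf := hf.comp (c * ·)

/-- The dual of `C^lc(𝔓)`. -/
abbrev DualPc := Module.Dual ℂ ↥(ClcP G)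

/-- Pairing of a functional on `C^lc(𝔓)` with a function on the shift space. -/
noncomputable def pairPc (lam : DualPc G) (g : ChainSp G → ℂ) : ℂ :=
  if h : IsLocallyConstant g then lam ⟨g, h⟩ else 0

/-! ## Vertex Laplacian -/

/-- The vertex Laplacian (averaging over neighbors). -/
noncomputable def vertexLap (f : X → ℂ) (x : X) : ℂ :=
  ((deg G x : ℂ))⁻¹ * ∑ᶠ e ∈ {e : DE G | ini e = x}, f (ter e)

/-- The function `χ(z)(x) = (z + q_x z⁻¹)/(q_x + 1)`. -/
noncomputable def chi (z : ℂ) (x : X) : ℂ :=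
  (z + ((deg G x : ℂ) - 1) * z⁻¹) / (deg G x : ℂ)

/-- The `χ(z)`-eigenspace of the vertex Laplacian. -/
def vertexEig (z : ℂ) : Set (X → ℂ) := {f | ∀ x, vertexLap G f x = chi G z x * f x}

/-! ## Miscellaneous -/

/-- Two subsets of complex vector spaces (in practice: subspaces) are linearly isomorphic. -/
def AreLinIso {M N : Type} [AddCommMonoid M] [Module ℂ M] [AddCommMonoid N] [Module ℂ N]
    (A : Set M) (B : Set N) : Prop :=
  ∃ F : M → N, Set.BijOn F A B ∧ (∀ a ∈ A, ∀ b ∈ A, F (a + b) = F a + F b) ∧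
    ∀ (c : ℂ), ∀ a ∈ A, F (c • a) = c • F a

/-- The `z`-eigenspace of the edge Laplacian as a submodule (for a locally finite graph). -/
noncomputable def edgeEigSub (hlf : LocFin G) (z : ℂ) : Submodule ℂ (DE G → ℂ) where
  carrier := edgeEig G z
  add_mem' := by
    intro f g hf hg e
    have hS : {e' : DE G | ini e' = ter e ∧ e' ≠ op e}.Finite :=
      (hlf (ter e)).subset fun _ h => h.1
    have : edgeLap G (f + g) e = edgeLap G f e + edgeLap G g e := by
      simpa [edgeLap] using finsum_mem_add_distrib (f := f) (g := g) hS
    rw [this, hf e, hg e, Pi.add_apply, mul_add]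
  zero_mem' := by
    intro e
    simp [edgeLap]
  smul_mem' := by
    intro c f hf e
    have hS : {e' : DE G | ini e' = ter e ∧ e' ≠ op e}.Finite :=
      (hlf (ter e)).subset fun _ h => h.1
    have : edgeLap G (c • f) e = c * edgeLap G f e := by
      simp only [edgeLap, Pi.smul_apply, smul_eq_mul]
      rw [finsum_mem_eq_finite_toFinset_sum _ hS, finsum_mem_eq_finite_toFinset_sum _ hS,
        Finset.mul_sum]
    rw [Pi.smul_apply, smul_eq_mul, this, hf e]; ring

/-- The cyclomatic number of a finite graph, as an integer. -/
noncomputable def cyclo : ℤ := (Nat.card G.edgeSet : ℤ) - (Nat.card X : ℤ) + 1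

/-- 2-colorability. -/
def TwoColorable : Prop := ∃ col : X → Bool, ∀ x y : X, G.Adj x y → col x ≠ col y

variable {G}

section Tree

/-- In a tree, a vertex has at most one neighbour closer to a given vertex `x`. -/
lemma eq_of_adj_of_dist_eq_add_one (hT : G.IsTree) {x u v w : X} (hu : G.Adj u v)
    (hw : G.Adj w v) (hdu : G.dist x v = G.dist x u + 1) (hdw : G.dist x v = G.dist x w + 1) :
    u = w := by
  obtain ⟨p, hp⟩ := hT.connected.exists_walk_length_eq_dist x u
  obtain ⟨q, hq⟩ := hT.connected.exists_walk_length_eq_dist x w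
  have hp' : (p.concat hu).IsPath := by
    apply SimpleGraph.Walk.isPath_of_length_eq_dist
    rw [SimpleGraph.Walk.length_concat, hp, hdu]
  have hq' : (q.concat hw).IsPath := by
    apply SimpleGraph.Walk.isPath_of_length_eq_dist
    rw [SimpleGraph.Walk.length_concat, hq, hdw]
  have h := (hT.isAcyclic.subsingleton_path x v).elim ⟨_, hp'⟩ ⟨_, hq'⟩
  have h2 := congrArg (fun p : G.Path x v => p.1.penultimate) h
  simpa using h2

/-- Once the distance to `x` increases along a ray, it keeps increasing. -/
lemma IsRay.dist_add (hT : G.IsTree) {r : ℕ → X} (hr : IsRay G r) (x : X) {m : ℕ}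
    (hm : G.dist x (r (m + 1)) = G.dist x (r m) + 1) (n : ℕ) :
    G.dist x (r (m + n)) = G.dist x (r m) + n := by
  have key : ∀ n, G.dist x (r (m + n + 1)) = G.dist x (r (m + n)) + 1 := by
    intro n
    induction n with
    | zero => exact hm
    | succ n ih =>
      rcases hT.dist_eq_dist_add_one_of_adj x (hr.1 (m + n + 1)) with h | h
      · exact absurd (eq_of_adj_of_dist_eq_add_one hT (hr.1 (m + n)) (hr.1 (m + n + 1)).symm ih h)
          (hr.2 (m + n)).symm
      · exact h
  induction n with
  | zero => rfl
  | succ n ih => rw [← add_assoc, key, ih, add_assoc]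

lemma IsRay.dist_start (hT : G.IsTree) {r : ℕ → X} (hr : IsRay G r) (n : ℕ) :
    G.dist (r 0) (r n) = n := by
  have h := hr.dist_add hT (r 0) (m := 0)
    (by simpa using SimpleGraph.dist_eq_one_iff_adj.2 (hr.1 0)) n
  simpa using h

lemma IsRay.injective (hT : G.IsTree) {r : ℕ → X} (hr : IsRay G r) : Injective r := by
  intro m n h
  rw [← hr.dist_start hT m, ← hr.dist_start hT n, h]

lemma IsRay.tail {r : ℕ → X} (hr : IsRay G r) : IsRay G fun n => r (n + 1) :=
  ⟨fun n => hr.1 (n + 1), fun n => hr.2 (n + 1)⟩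

/-- The distance to `x` along a ray is eventually the index up to a constant. -/
lemma IsRay.exists_eventually_dist (hT : G.IsTree) {r : ℕ → X} (hr : IsRay G r) (x : X) :
    ∃ c : ℤ, ∀ᶠ n : ℕ in Filter.atTop, (G.dist x (r n) : ℤ) = n + c := by
  obtain ⟨m, hm⟩ : ∃ m, G.dist x (r (m + 1)) = G.dist x (r m) + 1 := by
    by_contra! hne
    have hdec : ∀ n, G.dist x (r n) + n = G.dist x (r 0) := by
      intro n
      induction n with
      | zero => rfl
      | succ n ih =>
        have := (hT.dist_eq_dist_add_one_of_adj x (hr.1 n)).resolve_right (hne n)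
        omega
    have := hdec (G.dist x (r 0) + 1)
    omega
  refine ⟨G.dist x (r m) - m, Filter.eventually_atTop.2 ⟨m, fun n hn => ?_⟩⟩
  obtain ⟨k, rfl⟩ := Nat.exists_eq_add_of_le hn
  rw [hr.dist_add hT x hm k]
  push_cast
  ring

lemma exists_eventually_dist_sub (hT : G.IsTree) (r : Ray G) (a b : X) :
    ∃ k : ℤ, ∀ᶠ n in Filter.atTop, (G.dist a (r.1 n) : ℤ) - G.dist b (r.1 n) = k := by
  obtain ⟨c, hc⟩ := r.2.exists_eventually_dist hT a
  obtain ⟨d, hd⟩ := r.2.exists_eventually_dist hT b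
  refine ⟨c - d, ?_⟩
  filter_upwards [hc, hd] with n h1 h2
  rw [h1, h2]
  ring

lemma RayRel.exists_mem {r s : Ray G} (h : RayRel G r s) {A B : Set X}
    (hA : ∀ᶠ n in Filter.atTop, r.1 n ∈ A) (hB : ∀ᶠ n in Filter.atTop, s.1 n ∈ B) :
    (A ∩ B).Nonempty := by
  obtain ⟨M, hM⟩ := Filter.eventually_atTop.1 hA
  obtain ⟨N, hN⟩ := Filter.eventually_atTop.1 hB
  obtain ⟨v, ⟨⟨m, rfl⟩, ⟨n, hn⟩⟩, hv⟩ := h.exists_notMem_finite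
    (((Set.finite_Iio M).image r.1).union ((Set.finite_Iio N).image s.1))
  have hm : M ≤ m := not_lt.1 fun hlt => hv (Or.inl ⟨m, hlt, rfl⟩)
  have hn' : N ≤ n := not_lt.1 fun hlt => hv (Or.inr ⟨n, hlt, hn⟩)
  exact ⟨_, hM m hm, hn ▸ hN n hn'⟩

/-- The eventual value of `d(a, ·) - d(b, ·)` along a ray depends only on its endpoint. -/
lemma eventually_dist_sub_iff (hT : G.IsTree) {r s : Ray G}
    (h : Quot.mk (RayRel G) r = Quot.mk (RayRel G) s) (a b : X) (k : ℤ) :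
    (∀ᶠ n in Filter.atTop, (G.dist a (r.1 n) : ℤ) - G.dist b (r.1 n) = k) ↔
      ∀ᶠ n in Filter.atTop, (G.dist a (s.1 n) : ℤ) - G.dist b (s.1 n) = k := by
  induction Quot.eqvGen_exact h with
  | rel r s hrs =>
    obtain ⟨i, hi⟩ := exists_eventually_dist_sub hT r a b
    obtain ⟨j, hj⟩ := exists_eventually_dist_sub hT s a b
    obtain ⟨v, hv, hv'⟩ := hrs.exists_mem
      (A := {v | (G.dist a v : ℤ) - G.dist b v = i}) (B := {v | (G.dist a v : ℤ) - G.dist b v = j})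
      hi hj
    obtain rfl : i = j := hv.symm.trans hv'
    constructor
    · intro hk
      obtain ⟨n, h1, h2⟩ := (hi.and hk).exists
      exact h1.symm.trans h2 ▸ hj
    · intro hk
      obtain ⟨n, h1, h2⟩ := (hj.and hk).exists
      exact h1.symm.trans h2 ▸ hi
  | refl => rfl
  | symm r s hrs ih => exact (ih (Quot.eqvGen_sound hrs)).symm
  | trans r s t h1 h2 ih1 ih2 =>
    exact (ih1 (Quot.eqvGen_sound h1)).trans (ih2 (Quot.eqvGen_sound h2))

/-- Prepend a vertex to a ray. -/
def Ray.cons (x : X) (r : Ray G) (h : G.Adj x (r.1 0)) (hne : r.1 1 ≠ x) : Ray G :=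
  ⟨fun n => Nat.casesOn n x r.1, by
    constructor
    · rintro (_ | n)
      exacts [h, r.2.1 n]
    · rintro (_ | n)
      exacts [hne, r.2.2 n]⟩

lemma rayRel_of_range_subset (hT : G.IsTree) {r s : Ray G}
    (h : Set.range r.1 ⊆ Set.range s.1) : RayRel G r s := by
  rw [RayRel, Set.inter_eq_left.2 h]
  exact Set.infinite_range_of_injective (r.2.injective hT)

lemma Ray.mk_cons (hT : G.IsTree) {x : X} {r : Ray G} (h : G.Adj x (r.1 0))
    (hne : r.1 1 ≠ x) : Quot.mk (RayRel G) (r.cons x h hne) = Quot.mk (RayRel G) r := by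
  refine (Quot.sound (rayRel_of_range_subset hT ?_)).symm
  rintro _ ⟨n, rfl⟩
  exact ⟨n + 1, rfl⟩

/-- Every boundary point is represented by a ray starting at a given vertex. -/
lemma exists_ray_from (hT : G.IsTree) (x : X) (ω : Boundary G) :
    ∃ r : Ray G, Quot.mk (RayRel G) r = ω ∧ r.1 0 = x := by
  obtain ⟨s, rfl⟩ := Quot.exists_rep ω
  obtain ⟨p⟩ := hT.connected x (s.1 0)
  generalize hy : s.1 0 = y at p
  induction p with
  | nil => exact ⟨s, rfl, hy⟩
  | @cons u v w huv p ih =>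
    obtain ⟨r, hr, rfl⟩ := ih hy
    by_cases h1 : r.1 1 = u
    · refine ⟨⟨_, r.2.tail⟩, ?_, h1⟩
      rw [← hr]
      refine Quot.sound (rayRel_of_range_subset hT ?_)
      rintro _ ⟨n, rfl⟩
      exact ⟨n + 1, rfl⟩
    · exact ⟨r.cons u huv h1, (Ray.mk_cons hT huv h1).trans hr, rfl⟩

/-- The horocycle bracket is the eventual value of `d(o, ·) - d(x, ·)` along any ray. -/
lemma eventually_dist_sub_eq_horo (hT : G.IsTree) (o x : X) (r : Ray G) :
    ∀ᶠ n in Filter.atTop, (G.dist o (r.1 n) : ℤ) - G.dist x (r.1 n) =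
      horo G o x (Quot.mk (RayRel G) r) := by
  have hex : ∃ k : ℤ, ∀ s : Ray G, Quot.mk (RayRel G) s = Quot.mk (RayRel G) r → s.1 0 = o →
      ∃ N : ℕ, ∀ n : ℕ, N ≤ n → (G.dist x (s.1 n) : ℤ) = (n : ℤ) - k := by
    obtain ⟨k, hk⟩ := exists_eventually_dist_sub hT r o x
    refine ⟨k, fun s hs h0 => ?_⟩
    obtain ⟨N, hN⟩ := Filter.eventually_atTop.1 ((eventually_dist_sub_iff hT hs o x k).2 hk)
    refine ⟨N, fun n hn => ?_⟩
    have h1 := hN n hn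
    have h2 := s.2.dist_start hT n
    rw [h0] at h2
    omega
  obtain ⟨s, hs, h0⟩ := exists_ray_from hT o (Quot.mk (RayRel G) r)
  have hk : horo G o x (Quot.mk (RayRel G) r) = hex.choose := dif_pos hex
  rw [hk, ← eventually_dist_sub_iff hT hs]
  obtain ⟨N, hN⟩ := hex.choose_spec s hs h0
  filter_upwards [Filter.eventually_ge_atTop N] with n hn
  have h1 := hN n hn
  have h2 := s.2.dist_start hT n
  rw [h0] at h2
  omega

lemma horo_base (hT : G.IsTree) (o : X) (ω : Boundary G) : horo G o o ω = 0 := by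
  obtain ⟨r, rfl⟩ := Quot.exists_rep ω
  obtain ⟨n, hn⟩ := (eventually_dist_sub_eq_horo hT o o r).exists
  rw [← hn, sub_self]

/-- The horocycle bracket increases by one along an edge pointing towards the boundary point. -/
lemma horo_ter_of_mem (hT : G.IsTree) (o : X) {e : DE G} {ω : Boundary G}
    (h : ω ∈ plusBd G e) : horo G o (ter e) ω = horo G o (ini e) ω + 1 := by
  obtain ⟨r, rfl, h0, h1⟩ := h
  obtain ⟨n, ⟨ha, hb⟩, hn⟩ := ((eventually_dist_sub_eq_horo hT o (ini e) r).and
    (eventually_dist_sub_eq_horo hT o (ter e) r)).and (Filter.eventually_ge_atTop 1) |>.exists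
  obtain ⟨m, rfl⟩ := Nat.exists_eq_add_of_le' hn
  have h2 := r.2.dist_start hT (m + 1)
  have h3 : G.dist (r.1 1) (r.1 (m + 1)) = m := r.2.tail.dist_start hT m
  rw [h0] at h2
  rw [h1] at h3
  omega

lemma mem_plusBd_or_mem_plusBd_op (hT : G.IsTree) (e : DE G) (ω : Boundary G) :
    ω ∈ plusBd G e ∨ ω ∈ plusBd G (op e) := by
  obtain ⟨r, hr, h0⟩ := exists_ray_from hT (ini e) ω
  by_cases h1 : r.1 1 = ter e
  · exact Or.inl ⟨r, hr, h0, h1⟩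
  · have hadj : G.Adj (ter e) (r.1 0) := h0 ▸ e.2.symm
    exact Or.inr ⟨r.cons (ter e) hadj h1, (Ray.mk_cons hT hadj h1).trans hr, rfl, h0⟩

lemma plusBd_op (hT : G.IsTree) (e : DE G) : plusBd G (op e) = (plusBd G e)ᶜ := by
  ext ω
  refine ⟨fun h h' => ?_, (mem_plusBd_or_mem_plusBd_op hT e ω).resolve_left⟩
  have h1 : horo G (ini e) (ini e) ω = horo G (ini e) (ter e) ω + 1 :=
    horo_ter_of_mem hT (ini e) h
  have h2 := horo_ter_of_mem hT (ini e) h'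
  omega

lemma horo_ter_of_notMem (hT : G.IsTree) (o : X) {e : DE G} {ω : Boundary G}
    (h : ω ∉ plusBd G e) : horo G o (ter e) ω = horo G o (ini e) ω - 1 := by
  have h1 : horo G o (ini e) ω = horo G o (ter e) ω + 1 :=
    horo_ter_of_mem hT o (e := op e) (by rwa [plusBd_op hT])
  omega

lemma isOpen_plusBd (e : DE G) : IsOpen (plusBd G e) :=
  TopologicalSpace.isOpen_generateFrom_of_mem ⟨e, rfl⟩

lemma isLocallyConstant_indicator_plusBd (hT : G.IsTree) {M : Type*} [Zero M] [One M]
    (e : DE G) : IsLocallyConstant ((plusBd G e).indicator (1 : Boundary G → M)) := by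
  have hc : IsClopen (plusBd G e) :=
    ⟨isOpen_compl_iff.1 (plusBd_op hT e ▸ isOpen_plusBd (op e)), isOpen_plusBd e⟩
  refine (IsLocallyConstant.iff_exists_open _).2 fun ω => ?_
  by_cases h : ω ∈ plusBd G e
  · exact ⟨_, hc.isOpen, h, fun ω' h' => by simp [h, h']⟩
  · exact ⟨_, hc.compl.isOpen, h, fun ω' h' => by
      rw [Set.indicator_of_notMem h, Set.indicator_of_notMem h']⟩

lemma isLocallyConstant_horo (hT : G.IsTree) (o x : X) : IsLocallyConstant (horo G o x) := by
  obtain ⟨p⟩ := hT.connected x o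
  induction p with
  | nil =>
    exact IsLocallyConstant.of_constant _ fun ω ω' => by rw [horo_base hT, horo_base hT]
  | @cons u v w huv p ih =>
    let e : DE G := ⟨(v, u), huv.symm⟩
    convert ih.comp₂ (isLocallyConstant_indicator_plusBd (M := ℤ) hT e)
      (fun a b => a + 2 * b - 1) using 1
    funext ω
    by_cases h : ω ∈ plusBd G e
    · have h1 : horo G w u ω = horo G w v ω + 1 := horo_ter_of_mem hT w h
      simp only [Set.indicator_of_mem h, Pi.one_apply]
      omega
    · have h1 : horo G w u ω = horo G w v ω - 1 := horo_ter_of_notMem hT w h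
      simp only [Set.indicator_of_notMem h]
      omega

end Tree

variable (G)

/-- Relation between the scalar and the edge Poisson transforms. -/
theorem statement8 {X : Type} (G : SimpleGraph X) (hT : G.IsTree) (hlf : LocFin G)
    (hbd : ∃ D : ℕ, ∀ x : X, deg G x ≤ D) (hnd : ∀ x : X, 2 ≤ deg G x)
    (o : X) (z : ℂ) (hz : z ≠ 0) (μ : DualB G) (e : DE G) :
    z * poisson G o z μ (ter e) - poisson G o z μ (ini e) =
      (z ^ 2 - 1) * edgePoisson G o z μ e := by
  have hι : IsLocallyConstant fun ω => z ^ horo G o (ini e) ω :=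
    (isLocallyConstant_horo hT o (ini e)).comp (z ^ ·)
  have hτ : IsLocallyConstant fun ω => z ^ horo G o (ter e) ω :=
    (isLocallyConstant_horo hT o (ter e)).comp (z ^ ·)
  have he : IsLocallyConstant fun ω =>
      z ^ horo G o (ini e) ω * Set.indicator (plusBd G e) (1 : Boundary G → ℂ) ω :=
    hι.comp₂ (isLocallyConstant_indicator_plusBd hT e) (· * ·)
  rw [poisson, poisson, edgePoisson, pairB, pairB, pairB, dif_pos hι, dif_pos hτ, dif_pos he,
    ← smul_eq_mul, ← smul_eq_mul, ← map_smul, ← map_smul, ← map_sub]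
  congr 1
  ext ω
  change z * z ^ horo G o (ter e) ω - z ^ horo G o (ini e) ω =
    (z ^ 2 - 1) * (z ^ horo G o (ini e) ω * Set.indicator (plusBd G e) 1 ω)
  by_cases h : ω ∈ plusBd G e
  · rw [horo_ter_of_mem hT o h, Set.indicator_of_mem h, zpow_add_one₀ hz, Pi.one_apply]
    ring
  · rw [horo_ter_of_notMem hT o h, Set.indicator_of_notMem h, zpow_sub_one₀ hz]
    field_simp
    ring

end GraphQCC
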